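/- arXiv:math/0305131 — 2 statements merged into one kernel-verified Lean document; each statement's English description precedes it below -/
import Mathlib

section
/- ∫_0^∞ t·ln(1+t²)/(e^{2πt} − 1) dt = ζ'(−1) + ln √(2π) − 3/4, where ζ'(−1) is the derivative of the Riemann zeta function at −1. -/
open Real MeasureTheory Complex

/-- The kernel `1 / (exp (2 * π * t) - 1)`. -/
noncomputable def planckKernel (t : ℝ) : ℝ := (Real.exp (2 * π * t) - 1)⁻¹

lemma measurable_planckKernel : Measurable planckKernel := by
  unfold planckKernel; fun_prop

lemma exp_two_pi_mul_sub_one_pos {t : ℝ} (ht : 0 < t) : 0 < Real.exp (2 * π * t) - 1 := by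
  have : (1 : ℝ) < Real.exp (2 * π * t) := Real.one_lt_exp_iff.2 (by positivity)
  linarith

lemma planckKernel_pos {t : ℝ} (ht : 0 < t) : 0 < planckKernel t :=
  inv_pos.2 (exp_two_pi_mul_sub_one_pos ht)

lemma planckKernel_le {t : ℝ} (ht : 0 < t) :
    planckKernel t ≤ (2 * π)⁻¹ * (t⁻¹ * Real.exp (-π * t)) := by
  have h1 : π * t ≤ Real.sinh (π * t) := Real.self_le_sinh_iff.2 (by positivity)
  have h2 : 2 * π * t * Real.exp (π * t) ≤ Real.exp (2 * π * t) - 1 := by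
    have e1 : Real.exp (2 * π * t) - 1 = 2 * Real.sinh (π * t) * Real.exp (π * t) := by
      rw [Real.sinh_eq, show 2 * π * t = π * t + π * t by ring, Real.exp_add, Real.exp_neg]
      field_simp
    rw [e1]
    nlinarith [Real.exp_pos (π * t)]
  calc planckKernel t ≤ (2 * π * t * Real.exp (π * t))⁻¹ :=
        inv_anti₀ (by positivity) h2
    _ = _ := by rw [neg_mul, Real.exp_neg]; field_simp

lemma hasSum_planckKernel {t : ℝ} (ht : 0 < t) :
    HasSum (fun n : ℕ ↦ Real.exp (-(2 * π * (n + 1)) * t)) (planckKernel t) := by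
  have h : Real.exp (-(2 * π * t)) < 1 := Real.exp_lt_one_iff.2 (by linarith [mul_pos two_pi_pos ht])
  have := (hasSum_geometric_of_lt_one (Real.exp_pos _).le h).mul_left (Real.exp (-(2 * π * t)))
  have e : planckKernel t = Real.exp (-(2 * π * t)) * (1 - Real.exp (-(2 * π * t)))⁻¹ := by
    have := exp_two_pi_mul_sub_one_pos ht
    rw [planckKernel, Real.exp_neg]
    field_simp
  rw [e]
  refine this.congr_fun fun n ↦ ?_
  rw [← Real.exp_nat_mul, ← Real.exp_add]
  ring_nf

lemma integrableOn_rpow_mul_planckKernel {s : ℝ} (hs : 0 < s) :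
    IntegrableOn (fun t ↦ t ^ s * planckKernel t) (Set.Ioi 0) := by
  have h := (integrableOn_rpow_mul_exp_neg_mul_rpow (s := s - 1) (p := 1) (b := π)
    (by linarith) one_pos pi_pos).const_mul (2 * π)⁻¹
  refine Integrable.mono' h ?_ ?_
  · exact (Measurable.mul (by fun_prop) measurable_planckKernel).aestronglyMeasurable
  · refine (ae_restrict_iff' measurableSet_Ioi).2 (.of_forall fun t (ht : 0 < t) ↦ ?_)
    have h0 := planckKernel_pos ht
    rw [Real.norm_of_nonneg (by positivity)]
    calc t ^ s * planckKernel t ≤ t ^ s * ((2 * π)⁻¹ * (t⁻¹ * Real.exp (-π * t))) := by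
          gcongr; exact planckKernel_le ht
      _ = _ := by rw [Real.rpow_sub_one ht.ne', Real.rpow_one]; ring

lemma integrableOn_mul_planckKernel :
    IntegrableOn (fun t ↦ t * planckKernel t) (Set.Ioi 0) := by
  simpa using integrableOn_rpow_mul_planckKernel one_pos

lemma mellin_planckKernel {s : ℂ} (hs : 1 < s.re) :
    mellin (fun t ↦ (planckKernel t : ℂ)) s =
      (2 * π : ℂ) ^ (-s) * Complex.Gamma s * riemannZeta s := by
  have h := hasSum_mellin (a := fun _ : ℕ ↦ (1 : ℂ)) (p := fun n ↦ 2 * π * (n + 1))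
    (F := fun t ↦ (planckKernel t : ℂ)) (s := s) (fun n ↦ Or.inr (by positivity))
    (by linarith) (fun t ht ↦ by
      simp only [one_mul]
      exact_mod_cast Complex.hasSum_ofReal.2 (hasSum_planckKernel ht)) (by
      have := (summable_nat_add_iff 1).2 (Real.summable_one_div_nat_rpow.2 hs)
      refine (this.mul_left ((2 * π) ^ s.re)⁻¹).congr fun n ↦ ?_
      have e : (2 * π * (n + 1)) ^ s.re = (2 * π) ^ s.re * ((n + 1 : ℕ) : ℝ) ^ s.re := by
        rw [← Real.mul_rpow (by positivity) (by positivity)]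
        push_cast
        rfl
      rw [e, norm_one, one_div, one_div, mul_inv])
  rw [← h.tsum_eq, zeta_eq_tsum_one_div_nat_add_one_cpow hs, ← tsum_mul_left]
  congr 1; ext n
  have e : ((2 * π * (n + 1) : ℝ) : ℂ) ^ s = (2 * π : ℂ) ^ s * (n + 1 : ℂ) ^ s := by
    have := Complex.mul_cpow_ofReal_nonneg (a := 2 * π) (b := n + 1) (by positivity) (by positivity) s
    push_cast at this ⊢
    exact this
  rw [e, Complex.cpow_neg]
  field_simp

lemma hasDerivAt_mellin_planckKernel :
    MellinConvergent (fun t ↦ Real.log t • (planckKernel t : ℂ)) 2 ∧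
      HasDerivAt (mellin (fun t ↦ (planckKernel t : ℂ)))
        (mellin (fun t ↦ Real.log t • (planckKernel t : ℂ)) 2) 2 := by
  refine mellin_hasDerivAt_of_isBigO_rpow (a := 3) (b := 1) ?_ ?_ (by norm_num) ?_ (by norm_num)
  · refine ContinuousOn.locallyIntegrableOn ?_ measurableSet_Ioi
    refine Complex.continuous_ofReal.comp_continuousOn (ContinuousOn.inv₀ (by fun_prop) ?_)
    exact fun t ht ↦ (exp_two_pi_mul_sub_one_pos ht).ne'
  · have h := (isLittleO_exp_neg_mul_rpow_atTop pi_pos (-3)).isBigO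
    refine Asymptotics.IsBigO.trans ?_ h
    refine Asymptotics.IsBigO.of_bound 1 ?_
    filter_upwards [Filter.eventually_ge_atTop 1] with t ht
    have ht0 : 0 < t := by linarith
    have h0 := planckKernel_pos ht0
    rw [Complex.norm_real, Real.norm_of_nonneg h0.le, Real.norm_of_nonneg (Real.exp_pos _).le,
      one_mul]
    refine (planckKernel_le ht0).trans ?_
    have h1 : (2 * π)⁻¹ ≤ 1 := inv_le_one_of_one_le₀ (by linarith [pi_gt_three])
    have h2 : t⁻¹ ≤ 1 := inv_le_one_of_one_le₀ ht
    have h3 := Real.exp_pos (-π * t)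
    calc _ ≤ 1 * (1 * Real.exp (-π * t)) := by gcongr
      _ = _ := by ring
  · refine Asymptotics.IsBigO.of_bound 1 ?_
    filter_upwards [self_mem_nhdsWithin] with t (ht : 0 < t)
    have h0 := planckKernel_pos ht
    rw [Complex.norm_real, Real.norm_of_nonneg h0.le, Real.norm_of_nonneg (by positivity),
      one_mul, Real.rpow_neg_one]
    refine (planckKernel_le ht).trans ?_
    have h1 : (2 * π)⁻¹ ≤ 1 := inv_le_one_of_one_le₀ (by linarith [pi_gt_three])
    have h2 : Real.exp (-π * t) ≤ 1 := Real.exp_le_one_iff.2 (by nlinarith [pi_pos])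
    have h3 : 0 < t⁻¹ := by positivity
    calc _ ≤ 1 * (t⁻¹ * 1) := by gcongr
      _ = _ := by ring

lemma hasDerivAt_mellin_planckKernel_zeta :
    HasDerivAt (mellin (fun t ↦ (planckKernel t : ℂ))) (deriv riemannZeta (-1) / 2) 2 := by
  have hd := hasDerivAt_mellin_planckKernel.2
  set D := mellin (fun t ↦ Real.log t • (planckKernel t : ℂ)) 2
  have hz : HasDerivAt riemannZeta (deriv riemannZeta (-1)) (1 - 2) := by
    have : (1 - 2 : ℂ) = -1 := by norm_num
    rw [this]
    exact (differentiableAt_riemannZeta (by norm_num)).hasDerivAt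
  have h1 : HasDerivAt (fun s ↦ riemannZeta (1 - s)) (-deriv riemannZeta (-1)) 2 := by
    simpa using hz.comp_const_sub 1 2
  have h2 : HasDerivAt (fun s : ℂ ↦ 2 * Complex.cos (π * s / 2) *
      mellin (fun t ↦ (planckKernel t : ℂ)) s) (-2 * D) 2 := by
    have hc : HasDerivAt (fun s : ℂ ↦ Complex.cos (π * s / 2)) 0 2 := by
      have := (((hasDerivAt_id (2 : ℂ)).const_mul (π : ℂ)).div_const 2).ccos
      simpa using this
    have := (hc.const_mul 2).mul hd
    have e : (π : ℂ) * 2 / 2 = π := by ring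
    rw [e, Complex.cos_pi] at this
    refine this.congr_deriv ?_
    ring
  have h3 : (fun s ↦ riemannZeta (1 - s)) =ᶠ[nhds 2] fun s : ℂ ↦ 2 * Complex.cos (π * s / 2) *
      mellin (fun t ↦ (planckKernel t : ℂ)) s := by
    have : {s : ℂ | 1 < s.re} ∈ nhds (2 : ℂ) :=
      (isOpen_lt continuous_const Complex.continuous_re).mem_nhds (by simp)
    filter_upwards [this] with s (hs : 1 < s.re)
    rw [mellin_planckKernel hs, riemannZeta_one_sub]
    · ring
    · rintro n rfl
      simp at hs
      linarith [(Nat.cast_nonneg n : (0 : ℝ) ≤ n)]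
    · rintro rfl
      simp at hs
  have h4 := h1.unique (h2.congr_of_eventuallyEq h3)
  have : D = deriv riemannZeta (-1) / 2 := by linear_combination h4 / 2
  rwa [this] at hd

lemma integrableOn_mul_log_mul_planckKernel :
    IntegrableOn (fun t ↦ t * Real.log t * planckKernel t) (Set.Ioi 0) := by
  have h := hasDerivAt_mellin_planckKernel.1.re
  refine IntegrableOn.congr_fun h (fun t ht ↦ ?_) measurableSet_Ioi
  norm_num
  ring

lemma integral_mul_log_mul_planckKernel :
    ((∫ t in Set.Ioi (0 : ℝ), t * Real.log t * planckKernel t : ℝ) : ℂ) =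
      deriv riemannZeta (-1) / 2 := by
  rw [← hasDerivAt_mellin_planckKernel.2.unique hasDerivAt_mellin_planckKernel_zeta, mellin,
    ← integral_complex_ofReal]
  congr 1; ext t
  norm_num
  ring

lemma integral_exp_neg_mul_mul_sin {a : ℝ} (ha : 0 < a) (t : ℝ) :
    ∫ u in Set.Ioi (0 : ℝ), Real.exp (-a * u) * Real.sin (t * u) = t / (a ^ 2 + t ^ 2) := by
  have hre : (-a + t * I : ℂ).re < 0 := by simpa using ha
  have h := integral_exp_mul_complex_Ioi hre 0
  have hi := integrableOn_exp_mul_complex_Ioi hre 0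
  have h2 := congrArg Complex.im h
  have e (u : ℝ) : Real.exp (-a * u) * Real.sin (t * u) =
      (Complex.exp ((-a + t * I) * u)).im := by
    rw [Complex.exp_im]
    simp
  simp_rw [e]
  have h3 := integral_im hi
  simp only [RCLike.im_to_complex] at h3
  rw [h3, h]
  simp [Complex.div_im, Complex.normSq_apply]
  ring_nf

lemma integrableOn_mul_exp_neg_mul {a : ℝ} (ha : 0 < a) :
    IntegrableOn (fun u ↦ u * Real.exp (-a * u)) (Set.Ioi 0) := by
  simpa using integrableOn_rpow_mul_exp_neg_mul_rpow (s := 1) (p := 1) (b := a)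
    (by norm_num) one_pos ha

lemma integral_mul_exp_neg_mul {a : ℝ} (ha : 0 < a) :
    ∫ u in Set.Ioi (0 : ℝ), u * Real.exp (-a * u) = (a ^ 2)⁻¹ := by
  have := Real.integral_rpow_mul_exp_neg_mul_Ioi (a := 2) two_pos ha
  norm_num at this
  simpa using this

lemma integrableOn_exp_neg_mul_mul_sin {a : ℝ} (ha : 0 < a) (t : ℝ) :
    IntegrableOn (fun u ↦ Real.exp (-a * u) * Real.sin (t * u)) (Set.Ioi 0) := by
  refine Integrable.mono' (integrableOn_exp_mul_Ioi (neg_lt_zero.2 ha) 0) (by fun_prop) ?_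
  refine .of_forall fun u ↦ ?_
  rw [norm_mul, Real.norm_of_nonneg (Real.exp_pos _).le]
  exact mul_le_of_le_one_right (Real.exp_pos _).le (Real.abs_sin_le_one _)

/-- The function `1 / (exp u - 1) + 1 / 2 - 1 / u` in Binet's first formula. -/
noncomputable def binetKernel (u : ℝ) : ℝ := (Real.exp u - 1)⁻¹ + 1 / 2 - u⁻¹

lemma tsum_div_sq_add_sq {u : ℝ} (hu : 0 < u) :
    ∑' n : ℕ, u / ((2 * π * (n + 1)) ^ 2 + u ^ 2) = binetKernel u / 2 := by
  have hpi : (π : ℂ) ≠ 0 := by exact_mod_cast pi_ne_zero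
  have huc : (u : ℂ) ≠ 0 := by exact_mod_cast hu.ne'
  set x : ℂ := u * I / (2 * π) with hx
  have hxim : x.im = u / (2 * π) := by
    have : x = ((u / (2 * π) : ℝ) : ℂ) * I := by rw [hx]; push_cast; ring
    rw [this, Complex.im_ofReal_mul, Complex.I_im, mul_one]
  have hxmem : x ∈ Complex.integerComplement := by
    rw [Complex.mem_integerComplement_iff]
    rintro ⟨n, hn⟩
    have := congrArg Complex.im hn
    rw [hxim, Complex.intCast_im] at this
    have : 0 < u / (2 * π) := by positivity
    linarith
  have hc := cot_series_rep hxmem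
  have hs := tsum_pnat_eq_tsum_succ (f := fun n : ℕ ↦ 1 / (x - n) + 1 / (x + n))
  rw [hs] at hc
  have hterm (n : ℕ) : 1 / (x - (n + 1 : ℕ)) + 1 / (x + (n + 1 : ℕ)) =
      (-(4 * π * I)) * ((u / ((2 * π * (n + 1)) ^ 2 + u ^ 2) : ℝ) : ℂ) := by
    have h1 := Complex.integerComplement_add_ne_zero hxmem (n + 1 : ℕ)
    have h2 := Complex.integerComplement_add_ne_zero hxmem (-(n + 1 : ℕ))
    have h3 : ((2 * π * (n + 1)) ^ 2 + u ^ 2 : ℂ) ≠ 0 := by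
      have : (0 : ℝ) < (2 * π * (n + 1)) ^ 2 + u ^ 2 := by positivity
      exact_mod_cast this.ne'
    push_cast at h1 h2 ⊢
    rw [← sub_eq_add_neg] at h2
    rw [div_add_div _ _ h2 h1, mul_div_assoc', div_eq_div_iff (mul_ne_zero h2 h1) h3]
    have hxu : (u : ℂ) = -(2 * π * I) * x := by
      rw [hx]; field_simp; rw [Complex.I_sq]; ring
    rw [hxu]
    clear_value x
    linear_combination (8 * π ^ 2 * x * (n + 1) ^ 2) * Complex.I_sq
  simp_rw [hterm, tsum_mul_left, ← Complex.ofReal_tsum] at hc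
  have hE : Complex.exp u - 1 ≠ 0 := by
    have : (1 : ℝ) < Real.exp u := Real.one_lt_exp_iff.2 hu
    have h : Real.exp u - 1 ≠ 0 := by linarith
    exact_mod_cast h
  have hcot : Complex.cot (π * x) = -I * (1 + 2 / (Complex.exp u - 1)) := by
    have e1 : (π * x : ℂ) = u / 2 * I := by rw [hx]; field_simp
    have e2 : Complex.exp u = Complex.exp (u / 2) ^ 2 := by
      rw [← Complex.exp_nat_mul]; congr 1; push_cast; ring
    have h4 : Complex.sinh (u / 2) ≠ 0 := by
      have : (0:ℝ) < Real.sinh (u / 2) := Real.sinh_pos_iff.2 (by positivity)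
      exact_mod_cast this.ne'
    have e3 : Complex.cosh (u / 2) / Complex.sinh (u / 2) = 1 + 2 / (Complex.exp u - 1) := by
      rw [div_eq_iff h4]
      rw [Complex.cosh, Complex.sinh, Complex.exp_neg]
      have := Complex.exp_ne_zero (u / 2)
      rw [e2] at hE ⊢
      generalize Complex.exp (u / 2) = E at hE this ⊢
      field_simp
      ring
    rw [Complex.cot, e1, Complex.cos_mul_I, Complex.sin_mul_I, ← e3]
    field_simp
    rw [Complex.I_sq]; ring
  rw [hcot] at hc
  have hx1 : 1 / x = -(2 * π * I) / u := by
    rw [hx]; field_simp; rw [Complex.I_sq]; ring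
  rw [hx1] at hc
  have hfin : ((∑' n : ℕ, u / ((2 * π * (n + 1)) ^ 2 + u ^ 2) : ℝ) : ℂ) =
      ((binetKernel u / 2 : ℝ) : ℂ) := by
    rw [binetKernel]
    have hne : (4 * π * I : ℂ) ≠ 0 := by simp [hpi]
    apply mul_left_cancel₀ hne
    push_cast at hc ⊢
    rw [show (Complex.exp u - 1)⁻¹ = 1 / (Complex.exp u - 1) by ring]
    linear_combination hc
  exact_mod_cast hfin

lemma integral_sin_mul_planckKernel {u : ℝ} (hu : 0 < u) :
    ∫ t in Set.Ioi (0 : ℝ), planckKernel t * Real.sin (t * u) = binetKernel u / 2 := by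
  have hb (n : ℕ) : 0 < 2 * π * ((n : ℝ) + 1) := by positivity
  have hint (n : ℕ) := integrableOn_exp_neg_mul_mul_sin (hb n) u
  have key := hasSum_integral_of_summable_integral_norm (μ := volume.restrict (Set.Ioi (0 : ℝ)))
    (F := fun (n : ℕ) t ↦ Real.exp (-(2 * π * ((n : ℝ) + 1)) * t) * Real.sin (u * t)) hint ?_
  · simp_rw [integral_exp_neg_mul_mul_sin (hb _)] at key
    rw [← tsum_div_sq_add_sq hu, key.tsum_eq]
    refine setIntegral_congr_fun measurableSet_Ioi fun t ht ↦ ?_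
    have := (hasSum_planckKernel ht).mul_right (Real.sin (u * t))
    rw [this.tsum_eq, mul_comm t u]
  · have hs : Summable fun n : ℕ ↦ u * ((2 * π) ^ 2)⁻¹ * (1 / ((n + 1 : ℕ) : ℝ) ^ 2) :=
      ((summable_nat_add_iff 1).2 (Real.summable_one_div_nat_pow.2 one_lt_two)).mul_left _
    refine Summable.of_nonneg_of_le (fun n ↦ integral_nonneg fun t ↦ norm_nonneg _)
      (fun n ↦ ?_) hs
    calc _ ≤ ∫ t in Set.Ioi (0 : ℝ), u * (t * Real.exp (-(2 * π * ((n : ℝ) + 1)) * t)) := by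
          refine setIntegral_mono_on (hint n).norm
            ((integrableOn_mul_exp_neg_mul (hb n)).const_mul u) measurableSet_Ioi fun t ht ↦ ?_
          rw [norm_mul, Real.norm_of_nonneg (Real.exp_pos _).le]
          have h1 : ‖Real.sin (u * t)‖ ≤ u * t := by
            have := Real.abs_sin_le_abs (x := u * t)
            rwa [abs_of_pos (mul_pos hu ht)] at this
          calc _ ≤ Real.exp (-(2 * π * ((n : ℝ) + 1)) * t) * (u * t) := by gcongr
            _ = _ := by ring
      _ = _ := by
          rw [integral_const_mul, integral_mul_exp_neg_mul (hb n)]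
          push_cast
          rw [mul_pow, mul_inv]
          ring

/-- The integral `∫ 2 * t / ((a ^ 2 + t ^ 2) * (exp (2 * π * t) - 1))` over `(0, ∞)` of Binet's
second formula. -/
noncomputable def binetRemainder (a : ℝ) : ℝ :=
  ∫ t in Set.Ioi (0 : ℝ), 2 * t / (a ^ 2 + t ^ 2) * planckKernel t

lemma integrable_exp_neg_mul_binetKernel_and_integral {a : ℝ} (ha : 0 < a) :
    IntegrableOn (fun u ↦ Real.exp (-a * u) * binetKernel u) (Set.Ioi 0) ∧
      ∫ u in Set.Ioi (0 : ℝ), Real.exp (-a * u) * binetKernel u = binetRemainder a := by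
  set μ : Measure ℝ := volume.restrict (Set.Ioi 0) with hμ
  let F : ℝ → ℝ → ℝ := fun t u ↦
    2 * planckKernel t * (Real.exp (-a * u) * Real.sin (t * u))
  have hF : Integrable (Function.uncurry F) (μ.prod μ) := by
    refine Integrable.mono' ((integrableOn_mul_planckKernel.const_mul 2).mul_prod
      (integrableOn_mul_exp_neg_mul ha)) ?_ ?_
    · have h1 : Measurable fun z : ℝ × ℝ ↦ planckKernel z.1 :=
        measurable_planckKernel.comp measurable_fst
      refine Measurable.aestronglyMeasurable ?_
      exact (h1.const_mul 2).mul (by fun_prop)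
    · rw [hμ, Measure.prod_restrict]
      refine (ae_restrict_iff' (measurableSet_Ioi.prod measurableSet_Ioi)).2
        (.of_forall fun z hz ↦ ?_)
      obtain ⟨h1, h2⟩ := hz
      have h3 := planckKernel_pos h1
      have h4 : |Real.sin (z.1 * z.2)| ≤ z.1 * z.2 := by
        have := Real.abs_sin_le_abs (x := z.1 * z.2)
        rwa [abs_of_pos (a := z.1 * z.2) (mul_pos h1 h2)] at this
      simp only [Function.uncurry, F]
      rw [norm_mul, norm_mul (Real.exp _), Real.norm_of_nonneg (by positivity),
        Real.norm_of_nonneg (Real.exp_pos _).le, Real.norm_eq_abs]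
      calc _ ≤ 2 * planckKernel z.1 * (Real.exp (-a * z.2) * (z.1 * z.2)) := by gcongr
        _ = _ := by ring
  have hinner (u : ℝ) (hu : u ∈ Set.Ioi (0 : ℝ)) :
      ∫ t, F t u ∂μ = Real.exp (-a * u) * binetKernel u := by
    have := integral_sin_mul_planckKernel hu
    calc _ = ∫ t, (2 * Real.exp (-a * u)) * (planckKernel t * Real.sin (t * u)) ∂μ := by
          congr 1; ext t; simp only [F]; ring
      _ = _ := by rw [integral_const_mul, this]; ring
  constructor
  · exact IntegrableOn.congr_fun hF.integral_prod_right hinner measurableSet_Ioi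
  · rw [← setIntegral_congr_fun measurableSet_Ioi hinner, ← integral_integral_swap hF,
      binetRemainder]
    refine setIntegral_congr_fun measurableSet_Ioi fun t ht ↦ ?_
    simp only [F]
    rw [integral_const_mul, integral_exp_neg_mul_mul_sin ha]
    ring

lemma integral_exp_neg_mul {a : ℝ} (ha : 0 < a) :
    ∫ u in Set.Ioi (0 : ℝ), Real.exp (-a * u) = a⁻¹ := by
  rw [integral_exp_mul_Ioi (neg_lt_zero.2 ha)]
  simp [neg_div_neg_eq]

lemma binetRemainder_sub {a : ℝ} (ha : 0 < a) :
    binetRemainder a - binetRemainder (a + 1) =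
      (a⁻¹ + (a + 1)⁻¹) / 2 - (Real.log (a + 1) - Real.log a) := by
  have ha1 : 0 < a + 1 := by linarith
  obtain ⟨i1, e1⟩ := integrable_exp_neg_mul_binetKernel_and_integral ha
  obtain ⟨i2, e2⟩ := integrable_exp_neg_mul_binetKernel_and_integral ha1
  have j1 := integrableOn_exp_mul_Ioi (neg_lt_zero.2 ha) 0
  have j2 := integrableOn_exp_mul_Ioi (neg_lt_zero.2 ha1) 0
  have hj : IntegrableOn (fun u ↦ (Real.exp (-a * u) + Real.exp (-(a + 1) * u)) / 2)
      (Set.Ioi 0) := (j1.add j2).div_const 2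
  have hi : IntegrableOn (fun u ↦ Real.exp (-a * u) * binetKernel u -
      Real.exp (-(a + 1) * u) * binetKernel u) (Set.Ioi 0) := i1.sub i2
  have hfun (u : ℝ) (hu : u ∈ Set.Ioi (0 : ℝ)) :
      (Real.exp (-a * u) + Real.exp (-(a + 1) * u)) / 2 - (Real.exp (-a * u) * binetKernel u -
        Real.exp (-(a + 1) * u) * binetKernel u) =
      u⁻¹ • (Real.exp (-(a * u)) - Real.exp (-((a + 1) * u))) := by
    have h1 : (1 : ℝ) < Real.exp u := Real.one_lt_exp_iff.2 hu
    have h2 : Real.exp u - 1 ≠ 0 := by linarith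
    have h3 : u ≠ 0 := ne_of_gt hu
    have h4 : Real.exp (-a * u) = Real.exp (-(a + 1) * u) * Real.exp u := by
      rw [← Real.exp_add]; ring_nf
    rw [← neg_mul, ← neg_mul, h4, binetKernel, smul_eq_mul]
    field_simp
    ring
  have hfr := Frullani.integral_Ioi_eq (f := fun x : ℝ ↦ Real.exp (-x)) (a := a) (b := a + 1)
    (L := 1) (R := 0)
    ((by fun_prop : Continuous fun x : ℝ ↦ Real.exp (-x)).locallyIntegrable.locallyIntegrableOn _)
    ha ha1
    (by
      have : Continuous fun x : ℝ ↦ Real.exp (-x) := by fun_prop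
      simpa using (this.tendsto 0).mono_left nhdsWithin_le_nhds)
    Real.tendsto_exp_neg_atTop_nhds_zero
    (IntegrableOn.congr_fun (hj.sub hi) hfun measurableSet_Ioi)
  rw [← setIntegral_congr_fun measurableSet_Ioi hfun, integral_sub hj hi, integral_sub i1 i2,
    e1, e2, integral_div, integral_add j1 j2, integral_exp_neg_mul ha, integral_exp_neg_mul ha1,
    Real.log_div ha1.ne' ha.ne'] at hfr
  simp only [sub_zero, smul_eq_mul, mul_one] at hfr
  linarith

lemma binetRemainder_nonneg (a : ℝ) : 0 ≤ binetRemainder a :=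
  setIntegral_nonneg measurableSet_Ioi fun t (ht : 0 < t) ↦ by
    have := planckKernel_pos ht
    positivity

lemma binetRemainder_le {a : ℝ} (ha : 0 < a) :
    binetRemainder a ≤ 2 / a ^ 2 * ∫ t in Set.Ioi (0 : ℝ), t * planckKernel t := by
  rw [← integral_const_mul]
  refine integral_mono_of_nonneg ?_ (integrableOn_mul_planckKernel.const_mul _) ?_
  · refine (ae_restrict_iff' measurableSet_Ioi).2 (.of_forall fun t (ht : 0 < t) ↦ ?_)
    have := planckKernel_pos ht
    simp only [Pi.zero_apply]
    positivity
  · refine (ae_restrict_iff' measurableSet_Ioi).2 (.of_forall fun t (ht : 0 < t) ↦ ?_)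
    have := planckKernel_pos ht
    calc 2 * t / (a ^ 2 + t ^ 2) * planckKernel t ≤ 2 * t / (a ^ 2) * planckKernel t := by
          gcongr
          nlinarith
      _ = _ := by ring

lemma two_mul_mul_div_sq_add_sq_le {a t : ℝ} (ha : 0 < a) (ht : 0 < t) :
    2 * a * t / (a ^ 2 + t ^ 2) ≤ 2 * (a ^ (-(1 / 2) : ℝ) * t ^ (1 / 2 : ℝ)) := by
  rw [Real.rpow_neg ha.le, ← Real.sqrt_eq_rpow, ← Real.sqrt_eq_rpow, div_le_iff₀ (by positivity)]
  obtain ⟨x, hx, rfl⟩ : ∃ x, 0 < x ∧ a = x ^ 2 := ⟨√a, by positivity, by simp [ha.le]⟩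
  obtain ⟨y, hy, rfl⟩ : ∃ y, 0 < y ∧ t = y ^ 2 := ⟨√t, by positivity, by simp [ht.le]⟩
  rw [Real.sqrt_sq hx.le, Real.sqrt_sq hy.le]
  have h : x ^ 3 * y ≤ (x ^ 2) ^ 2 + (y ^ 2) ^ 2 := by
    rcases le_total x y with h | h
    · nlinarith [pow_le_pow_left₀ hx.le h 3, pow_pos hx 4, pow_pos hy 4]
    · nlinarith [pow_pos hx 3, pow_pos hy 4, mul_le_mul_of_nonneg_left h (pow_pos hx 3).le]
  calc 2 * x ^ 2 * y ^ 2 = 2 * (x⁻¹ * y) * (x ^ 3 * y) := by field_simp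
    _ ≤ _ := by gcongr

lemma integral_two_mul_mul_div_sq_add_sq {t : ℝ} (ht : 0 < t) :
    ∫ a in Set.Ioc (0 : ℝ) 1, 2 * a * t / (a ^ 2 + t ^ 2) =
      t * (Real.log (1 + t ^ 2) - 2 * Real.log t) := by
  rw [← intervalIntegral.integral_of_le zero_le_one,
    intervalIntegral.integral_eq_sub_of_hasDerivAt (f := fun a ↦ t * Real.log (a ^ 2 + t ^ 2))]
  · simp
    ring
  · intro a _
    have h := (((hasDerivAt_id a).pow 2).add_const (t ^ 2)).log (by simp; positivity)
    refine (h.const_mul t).congr_deriv ?_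
    simp
    ring
  · refine Continuous.intervalIntegrable ?_ _ _
    exact Continuous.div (by fun_prop) (by fun_prop) fun a ↦ by positivity

lemma intervalIntegrable_mul_binetRemainder_and_integral :
    IntervalIntegrable (fun a ↦ a * binetRemainder a) volume 0 1 ∧
    IntegrableOn (fun t ↦ t * (Real.log (1 + t ^ 2) - 2 * Real.log t) * planckKernel t)
      (Set.Ioi 0) ∧
    ∫ t in Set.Ioi (0 : ℝ), t * (Real.log (1 + t ^ 2) - 2 * Real.log t) * planckKernel t =
      ∫ a in (0 : ℝ)..1, a * binetRemainder a := by
  set μ : Measure ℝ := volume.restrict (Set.Ioi 0) with hμ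
  set ν : Measure ℝ := volume.restrict (Set.Ioc 0 1) with hν
  let F : ℝ → ℝ → ℝ := fun t a ↦ 2 * a * t / (a ^ 2 + t ^ 2) * planckKernel t
  have hF : Integrable (Function.uncurry F) (μ.prod ν) := by
    have hrp : IntegrableOn (fun a : ℝ ↦ a ^ (-(1 / 2) : ℝ)) (Set.Ioc 0 1) :=
      (intervalIntegrable_iff_integrableOn_Ioc_of_le zero_le_one).1
        (intervalIntegral.intervalIntegrable_rpow' (by norm_num))
    refine Integrable.mono' (((integrableOn_rpow_mul_planckKernel
      (one_half_pos (α := ℝ))).const_mul 2).mul_prod hrp) ?_ ?_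
    · have h1 : Measurable fun z : ℝ × ℝ ↦ planckKernel z.1 :=
        measurable_planckKernel.comp measurable_fst
      refine Measurable.aestronglyMeasurable (Measurable.mul ?_ h1)
      fun_prop
    · rw [hμ, hν, Measure.prod_restrict]
      refine (ae_restrict_iff' (measurableSet_Ioi.prod measurableSet_Ioc)).2
        (.of_forall fun z hz ↦ ?_)
      obtain ⟨h1, h2, -⟩ := hz
      have h1' : 0 < z.1 := h1
      have h3 := planckKernel_pos h1
      simp only [Function.uncurry, F]
      rw [Real.norm_of_nonneg (by positivity)]
      calc _ ≤ 2 * (z.2 ^ (-(1 / 2) : ℝ) * z.1 ^ (1 / 2 : ℝ)) * planckKernel z.1 := by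
            gcongr
            exact two_mul_mul_div_sq_add_sq_le h2 h1
        _ = _ := by ring
  have h1 (a : ℝ) : ∫ t, F t a ∂μ = a * binetRemainder a := by
    rw [binetRemainder, ← integral_const_mul]
    congr 1; ext t; simp only [F]; ring
  have h2 (t : ℝ) (ht : t ∈ Set.Ioi (0 : ℝ)) : ∫ a, F t a ∂ν =
      t * (Real.log (1 + t ^ 2) - 2 * Real.log t) * planckKernel t := by
    simp only [F]
    rw [integral_mul_const, integral_two_mul_mul_div_sq_add_sq ht]
  refine ⟨?_, ?_, ?_⟩
  · rw [intervalIntegrable_iff_integrableOn_Ioc_of_le zero_le_one]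
    exact hF.integral_prod_right.congr (.of_forall h1)
  · exact IntegrableOn.congr_fun hF.integral_prod_left h2 measurableSet_Ioi
  · rw [intervalIntegral.integral_of_le zero_le_one]
    simp_rw [← h1]
    rw [← setIntegral_congr_fun measurableSet_Ioi h2, integral_integral_swap hF]

lemma binetRemainder_eq_sum_add {a : ℝ} (ha : 0 < a) (N : ℕ) :
    binetRemainder a = ∑ n ∈ Finset.range N, (((a + n)⁻¹ + (a + (n + 1 : ℕ))⁻¹) / 2 -
      (Real.log (a + (n + 1 : ℕ)) - Real.log (a + n))) + binetRemainder (a + N) := by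
  induction N with
  | zero => simp
  | succ N ih =>
    have := binetRemainder_sub (a := a + N) (by positivity)
    rw [Finset.sum_range_succ, ih]
    push_cast
    rw [← add_assoc a]
    linarith

lemma intervalIntegrable_mul_inv_add_nat_and_integral (n : ℕ) :
    IntervalIntegrable (fun a : ℝ ↦ a * (a + n)⁻¹) volume 0 1 ∧
      ∫ a in (0 : ℝ)..1, a * (a + n)⁻¹ = 1 - n * (Real.log (n + 1) - Real.log n) := by
  rcases Nat.eq_zero_or_pos n with rfl | hn
  · have h : Set.EqOn (fun _ : ℝ ↦ (1 : ℝ)) (fun a : ℝ ↦ a * (a + (0 : ℕ))⁻¹) (Set.uIoc 0 1) := by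
      intro a ha
      rw [Set.uIoc_of_le zero_le_one] at ha
      have : a ≠ 0 := ha.1.ne'
      simp [this]
    refine ⟨(intervalIntegrable_const (c := (1 : ℝ))).congr h, ?_⟩
    rw [← intervalIntegral.integral_congr_ae (.of_forall fun a ha ↦ h ha)]
    simp
  · have hn' : (0 : ℝ) < n := by exact_mod_cast hn
    have hi : IntervalIntegrable (fun a : ℝ ↦ a * (a + n)⁻¹) volume 0 1 := by
      refine ContinuousOn.intervalIntegrable (ContinuousOn.mul (by fun_prop)
        (ContinuousOn.inv₀ (by fun_prop) fun a ha ↦ ?_))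
      rw [Set.uIcc_of_le zero_le_one] at ha
      linarith [ha.1]
    refine ⟨hi, ?_⟩
    rw [intervalIntegral.integral_eq_sub_of_hasDerivAt
      (f := fun a ↦ a - n * Real.log (a + n)) ?_ hi]
    · rw [zero_add, add_comm (1 : ℝ)]; ring
    · intro a ha
      rw [Set.uIcc_of_le zero_le_one] at ha
      have h0 : a + n ≠ 0 := by linarith [ha.1]
      have h := ((hasDerivAt_id a).add_const (n : ℝ)).log h0
      refine ((hasDerivAt_id a).sub (h.const_mul (n : ℝ))).congr_deriv ?_
      simp only [id]
      field_simp
      ring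

lemma intervalIntegrable_mul_log_add_nat_and_integral (n : ℕ) :
    IntervalIntegrable (fun a : ℝ ↦ a * Real.log (a + n)) volume 0 1 ∧
      ∫ a in (0 : ℝ)..1, a * Real.log (a + n) =
        (1 - n ^ 2) / 2 * Real.log (n + 1) + n ^ 2 / 2 * Real.log n - 1 / 4 + n / 2 := by
  have hn : (0 : ℝ) ≤ n := n.cast_nonneg
  have hmul : ContinuousOn (fun a : ℝ ↦ (n : ℝ) * Real.log (a + n)) (Set.Icc 0 1) := by
    rcases Nat.eq_zero_or_pos n with rfl | hn
    · simpa using continuousOn_const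
    · have hn' : (0 : ℝ) < n := by exact_mod_cast hn
      refine ContinuousOn.mul continuousOn_const (ContinuousOn.log (by fun_prop) fun a ha ↦ ?_)
      linarith [ha.1]
  have hml : Continuous fun a : ℝ ↦ (a + n) * Real.log (a + n) :=
    Real.continuous_mul_log.comp (continuous_add_const (n : ℝ))
  have hc : ContinuousOn (fun a : ℝ ↦ a * Real.log (a + n)) (Set.Icc 0 1) :=
    (hml.continuousOn.sub hmul).congr fun a _ ↦ by simp only [Pi.sub_apply]; ring
  have hi : IntervalIntegrable (fun a : ℝ ↦ a * Real.log (a + n)) volume 0 1 :=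
    ContinuousOn.intervalIntegrable_of_Icc zero_le_one hc
  refine ⟨hi, ?_⟩
  rw [intervalIntegral.integral_eq_sub_of_hasDerivAt_of_le zero_le_one
    (f := fun a ↦ (a - n) / 2 * ((a + n) * Real.log (a + n)) - a ^ 2 / 4 + n * a / 2) ?_ ?_ hi]
  · rw [zero_add, add_comm (1 : ℝ)]; ring
  · exact (((by fun_prop : Continuous fun a : ℝ ↦ (a - n) / 2).mul hml).sub (by fun_prop)).add
      (by fun_prop) |>.continuousOn
  · intro a ha
    have h0 : a + n ≠ 0 := by linarith [ha.1]
    have h1 := (hasDerivAt_id a).add_const (n : ℝ)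
    have h2 := (((hasDerivAt_id a).sub_const (n : ℝ)).div_const 2).mul (h1.mul (h1.log h0))
    refine ((h2.sub (((hasDerivAt_id a).pow 2).div_const 4)).add
      (((hasDerivAt_id a).const_mul (n : ℝ)).div_const 2)).congr_deriv ?_
    simp only [id, Pi.mul_apply]
    field_simp
    ring

lemma intervalIntegrable_binet_term_and_integral (n : ℕ) :
    IntervalIntegrable (fun a : ℝ ↦ a * (((a + n)⁻¹ + (a + (n + 1 : ℕ))⁻¹) / 2 -
      (Real.log (a + (n + 1 : ℕ)) - Real.log (a + n)))) volume 0 1 ∧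
    ∫ a in (0 : ℝ)..1, a * (((a + n)⁻¹ + (a + (n + 1 : ℕ))⁻¹) / 2 -
      (Real.log (a + (n + 1 : ℕ)) - Real.log (a + n))) =
      (n ^ 2 + n - 1) / 2 * Real.log (n + 2) + (1 / 2 - n ^ 2 - n) * Real.log (n + 1) +
        (n ^ 2 + n) / 2 * Real.log n + 1 / 2 := by
  obtain ⟨i1, e1⟩ := intervalIntegrable_mul_inv_add_nat_and_integral n
  obtain ⟨i2, e2⟩ := intervalIntegrable_mul_inv_add_nat_and_integral (n + 1)
  obtain ⟨i3, e3⟩ := intervalIntegrable_mul_log_add_nat_and_integral n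
  obtain ⟨i4, e4⟩ := intervalIntegrable_mul_log_add_nat_and_integral (n + 1)
  have hA := (i1.add i2).div_const 2
  have hB := i4.sub i3
  have e : (fun a : ℝ ↦ a * (((a + n)⁻¹ + (a + (n + 1 : ℕ))⁻¹) / 2 -
      (Real.log (a + (n + 1 : ℕ)) - Real.log (a + n)))) =
      fun a : ℝ ↦ (a * (a + n)⁻¹ + a * (a + (n + 1 : ℕ))⁻¹) / 2 -
        (a * Real.log (a + (n + 1 : ℕ)) - a * Real.log (a + n)) := by
    ext a; ring
  rw [e]
  refine ⟨hA.sub hB, ?_⟩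
  rw [intervalIntegral.integral_sub hA hB, intervalIntegral.integral_div,
    intervalIntegral.integral_add i1 i2, intervalIntegral.integral_sub i4 i3, e1, e2, e3, e4]
  push_cast
  rw [show (n : ℝ) + 1 + 1 = n + 2 by ring]
  ring

lemma sum_binet_integral (N : ℕ) :
    ∑ n ∈ Finset.range N, ((n ^ 2 + n - 1) / 2 * Real.log (n + 2) +
      (1 / 2 - n ^ 2 - n) * Real.log (n + 1) + (n ^ 2 + n) / 2 * Real.log n + 1 / 2) =
    (N ^ 2 - N) / 2 * (Real.log (N + 1) - Real.log N) - N * Real.log N +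
      Real.log N.factorial - Real.log (N + 1) / 2 + N / 2 := by
  induction N with
  | zero => simp
  | succ N ih =>
    rw [Finset.sum_range_succ, ih, Nat.factorial_succ]
    push_cast
    rw [Real.log_mul (by positivity) (by positivity), show (N : ℝ) + 1 + 1 = N + 2 by ring]
    ring

open Filter Topology in
lemma tendsto_sq_mul_log_succ_sub :
    Tendsto (fun N : ℕ ↦ (N : ℝ) ^ 2 * (Real.log (N + 1) - Real.log N) - N) atTop
      (𝓝 (-1 / 2)) := by
  have hlim : Tendsto (fun N : ℕ ↦ ((N : ℝ) - 1)⁻¹) atTop (𝓝 0) :=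
    tendsto_inv_atTop_zero.comp (tendsto_atTop_add_const_right _ (-1) tendsto_natCast_atTop_atTop)
  rw [tendsto_iff_norm_sub_tendsto_zero]
  refine squeeze_zero' (.of_forall fun _ ↦ norm_nonneg _) ?_ hlim
  filter_upwards [eventually_ge_atTop 2] with N hN
  have hN' : (2 : ℝ) ≤ N := by exact_mod_cast hN
  have hN0 : (0 : ℝ) < N := by linarith
  have habs : |-(N : ℝ)⁻¹| = (N : ℝ)⁻¹ := by rw [abs_neg, abs_of_pos (by positivity)]
  have h := Real.abs_log_sub_add_sum_range_le (x := -(N : ℝ)⁻¹)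
    (by rw [habs]; exact inv_lt_one_of_one_lt₀ (by linarith)) 2
  have hlog : Real.log (1 - -(N : ℝ)⁻¹) = Real.log (N + 1) - Real.log N := by
    rw [← Real.log_div (by positivity) hN0.ne']
    congr 1
    field_simp
    ring
  rw [hlog, habs] at h
  have h1 : (N : ℝ) ^ 2 * (Real.log (N + 1) - Real.log N) - N - -1 / 2 =
      (N : ℝ) ^ 2 * ((∑ i ∈ Finset.range 2, (-(N : ℝ)⁻¹) ^ (i + 1) / (i + 1)) +
        (Real.log (N + 1) - Real.log N)) := by
    simp [Finset.sum_range_succ]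
    field_simp
    ring
  rw [h1, norm_mul, Real.norm_of_nonneg (by positivity), Real.norm_eq_abs]
  refine (mul_le_mul_of_nonneg_left h (by positivity)).trans_eq ?_
  have : (N : ℝ) - 1 ≠ 0 := by linarith
  rw [inv_pow]
  field_simp

open Filter Topology in
lemma tendsto_sum_binet_integral :
    Tendsto (fun N : ℕ ↦ ((N : ℝ) ^ 2 - N) / 2 * (Real.log (N + 1) - Real.log N) -
      N * Real.log N + Real.log N.factorial - Real.log (N + 1) / 2 + N / 2) atTop
      (𝓝 (Real.log (√(2 * π)) - 3 / 4)) := by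
  have h2 := tendsto_sq_mul_log_succ_sub
  have hinv : Tendsto (fun N : ℕ ↦ (N : ℝ)⁻¹) atTop (𝓝 0) :=
    tendsto_inv_atTop_zero.comp tendsto_natCast_atTop_atTop
  have h1 : Tendsto (fun N : ℕ ↦ (N : ℝ) * (Real.log (N + 1) - Real.log N)) atTop (𝓝 1) := by
    have := (h2.mul hinv).add_const 1
    simp only [mul_zero, zero_add] at this
    refine this.congr' ?_
    filter_upwards [eventually_gt_atTop 0] with N hN
    field_simp
    ring
  have h0 : Tendsto (fun N : ℕ ↦ Real.log (N + 1) - Real.log N) atTop (𝓝 0) := by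
    have := h1.mul hinv
    simp only [mul_zero] at this
    refine this.congr' ?_
    filter_upwards [eventually_gt_atTop 0] with N hN
    field_simp
  have hS := (Stirling.tendsto_stirlingSeq_sqrt_pi).log (by positivity)
  have h := ((((hS.add_const (Real.log 2 / 2)).add (h2.div_const 2)).sub
    (h1.div_const 2))).sub (h0.div_const 2)
  have e : Real.log √π + Real.log 2 / 2 + -1 / 2 / 2 - 1 / 2 - 0 / 2 =
      Real.log (√(2 * π)) - 3 / 4 := by
    rw [Real.log_sqrt pi_pos.le, Real.log_sqrt (by positivity), Real.log_mul two_ne_zero pi_ne_zero]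
    ring
  rw [e] at h
  refine h.congr' ?_
  filter_upwards [eventually_gt_atTop 0] with N hN
  have hN0 : (N : ℝ) ≠ 0 := by positivity
  rw [Stirling.log_stirlingSeq_formula, Real.log_mul two_ne_zero hN0,
    Real.log_div hN0 (Real.exp_pos _).ne', Real.log_exp]
  ring

open Filter Topology in
lemma integral_mul_binetRemainder :
    ∫ a in (0 : ℝ)..1, a * binetRemainder a = Real.log (√(2 * π)) - 3 / 4 := by
  obtain ⟨hK, -, -⟩ := intervalIntegrable_mul_binetRemainder_and_integral
  set C := ∫ t in Set.Ioi (0 : ℝ), t * planckKernel t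
  have hlim : Tendsto (fun N : ℕ ↦ 2 / (N : ℝ) ^ 2 * C) atTop (𝓝 0) := by
    have : Tendsto (fun N : ℕ ↦ (N : ℝ)⁻¹) atTop (𝓝 0) :=
      tendsto_inv_atTop_zero.comp tendsto_natCast_atTop_atTop
    have := ((this.pow 2).const_mul 2).mul_const C
    simpa [div_eq_mul_inv] using this
  refine tendsto_nhds_unique ?_ tendsto_sum_binet_integral
  rw [tendsto_iff_norm_sub_tendsto_zero]
  refine squeeze_zero' (.of_forall fun _ ↦ norm_nonneg _) ?_ hlim
  filter_upwards [eventually_gt_atTop 0] with N hN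
  have hN' : (0 : ℝ) < N := by exact_mod_cast hN
  have hi (n : ℕ) := (intervalIntegrable_binet_term_and_integral n).1
  rw [← sum_binet_integral, ← Finset.sum_congr rfl
    fun n _ ↦ (intervalIntegrable_binet_term_and_integral n).2, norm_sub_rev,
    ← intervalIntegral.integral_finsetSum fun n _ ↦ hi n,
    ← intervalIntegral.integral_sub hK (by
      simpa only [Finset.sum_fn] using IntervalIntegrable.sum (Finset.range N) fun n _ ↦ hi n)]
  have hb : ∀ a ∈ Set.uIoc (0 : ℝ) 1, ‖a * binetRemainder a -
      ∑ n ∈ Finset.range N, a * (((a + n)⁻¹ + (a + (n + 1 : ℕ))⁻¹) / 2 -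
        (Real.log (a + (n + 1 : ℕ)) - Real.log (a + n)))‖ ≤ 2 / (N : ℝ) ^ 2 * C := by
    intro a ha
    rw [Set.uIoc_of_le zero_le_one] at ha
    obtain ⟨ha0, ha1⟩ := ha
    rw [← Finset.mul_sum, ← mul_sub, binetRemainder_eq_sum_add ha0 N, add_sub_cancel_left]
    have h0 := binetRemainder_nonneg (a + N)
    have hC : 0 ≤ C := setIntegral_nonneg measurableSet_Ioi fun t ht ↦
      mul_nonneg (le_of_lt ht) (planckKernel_pos ht).le
    rw [Real.norm_of_nonneg (by positivity)]
    calc a * binetRemainder (a + N) ≤ 1 * binetRemainder (a + N) := by gcongr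
      _ ≤ 2 / (a + N) ^ 2 * C := by rw [one_mul]; exact binetRemainder_le (by positivity)
      _ ≤ _ := by gcongr; linarith
  simpa using intervalIntegral.norm_integral_le_of_norm_le_const hb

theorem integral_L1_one :
    ((∫ t in Set.Ioi (0 : ℝ),
        t * Real.log (1 + t ^ 2) / (Real.exp (2 * π * t) - 1) : ℝ) : ℂ) =
      deriv riemannZeta (-1) + (Real.log (Real.sqrt (2 * π)) : ℂ) - 3 / 4 := by
  obtain ⟨-, hi, he⟩ := intervalIntegrable_mul_binetRemainder_and_integral
  have hsplit : ∫ t in Set.Ioi (0 : ℝ), t * Real.log (1 + t ^ 2) / (Real.exp (2 * π * t) - 1) =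
      (∫ t in Set.Ioi (0 : ℝ), t * (Real.log (1 + t ^ 2) - 2 * Real.log t) * planckKernel t) +
        2 * ∫ t in Set.Ioi (0 : ℝ), t * Real.log t * planckKernel t := by
    rw [← integral_const_mul, ← integral_add hi (integrableOn_mul_log_mul_planckKernel.const_mul 2)]
    congr 1
    ext t
    rw [planckKernel]
    ring
  rw [hsplit, he, integral_mul_binetRemainder]
  push_cast
  rw [integral_mul_log_mul_planckKernel]
  ring
end

section
/- ∫_0^∞ arctan(t)/sinh(πt) dt = (1/2) ln π − (1/2) ln 2. -/
open Real MeasureTheory Filter Topology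

theorem hasSum_one_div_sq_add_succ_sq {y : ℝ} (hy : 0 < y) :
    HasSum (fun n : ℕ => 1 / (y ^ 2 + ((n : ℝ) + 1) ^ 2))
      ((π * (cosh (π * y) / sinh (π * y)) - 1 / y) / (2 * y)) := by
  have hs : Summable (fun n : ℕ => 1 / (y ^ 2 + ((n : ℝ) + 1) ^ 2)) := by
    have h1 := (summable_nat_add_iff 1).2 (Real.summable_one_div_nat_pow.2 one_lt_two)
    refine h1.of_nonneg_of_le (fun n => by positivity) fun n => ?_
    push_cast
    gcongr
    nlinarith
  have hx : (y * Complex.I : ℂ) ∈ Complex.integerComplement := by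
    rintro ⟨n, hn⟩
    have := congrArg Complex.im hn
    simp at this
    exact hy.ne this
  have hc := cot_series_rep' hx
  have hy' : (y : ℂ) ≠ 0 := by exact_mod_cast hy.ne'
  have hterm : ∀ n : ℕ, (1 / (y * Complex.I - (n + 1)) + 1 / (y * Complex.I + (n + 1)) : ℂ)
      = (-2 * y * Complex.I) * ((1 / (y ^ 2 + ((n : ℝ) + 1) ^ 2) : ℝ) : ℂ) := by
    intro n
    have h1 : (y * Complex.I - (n + 1) : ℂ) ≠ 0 := by
      intro h
      have := congrArg Complex.im h
      simp at this
      exact hy.ne' this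
    have h2 : (y * Complex.I + (n + 1) : ℂ) ≠ 0 := by
      intro h
      have := congrArg Complex.im h
      simp at this
      exact hy.ne' this
    have h3 : ((y : ℂ) ^ 2 + ((n : ℂ) + 1) ^ 2) ≠ 0 := by
      have : (0 : ℝ) < y ^ 2 + ((n : ℝ) + 1) ^ 2 := by positivity
      exact_mod_cast this.ne'
    push_cast
    field_simp
    linear_combination (2 * y ^ 3 * Complex.I) * Complex.I_sq
  simp_rw [hterm] at hc
  rw [tsum_mul_left, ← Complex.ofReal_tsum] at hc
  have hsin : ((sinh (π * y) : ℝ) : ℂ) ≠ 0 := by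
    exact_mod_cast (Real.sinh_pos_iff.2 (by positivity)).ne'
  rw [Complex.cot, ← mul_assoc, Complex.cos_mul_I, Complex.sin_mul_I, ← Complex.ofReal_mul,
    ← Complex.ofReal_cosh, ← Complex.ofReal_sinh] at hc
  convert hs.hasSum using 1
  rw [← Complex.ofReal_inj]
  push_cast at hc hsin ⊢
  field_simp at hc ⊢
  linear_combination hc - 2 * y ^ 2 * Complex.sinh (π * y) *
    (∑' a : ℕ, 1 / ((y : ℂ) ^ 2 + ((a : ℂ) + 1) ^ 2)) * Complex.I_sq

theorem hasSum_one_div_sq_add_odd_sq {y : ℝ} (hy : 0 < y) :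
    HasSum (fun n : ℕ => 1 / (y ^ 2 + (2 * (n : ℝ) + 1) ^ 2)) (π / (4 * y) * tanh (π * y / 2)) := by
  have h1 := hasSum_one_div_sq_add_succ_sq hy
  have h2 := (hasSum_one_div_sq_add_succ_sq (half_pos hy)).mul_left (1 / 4)
  have hodd : HasSum (fun n : ℕ => 1 / (y ^ 2 + (((2 * n + 1 : ℕ) : ℝ) + 1) ^ 2))
      (1 / 4 * ((π * (cosh (π * (y / 2)) / sinh (π * (y / 2))) - 1 / (y / 2)) / (2 * (y / 2)))) := by
    convert! h2 using 1
    funext n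
    push_cast
    field_simp
    ring
  have heven : Summable fun n : ℕ => 1 / (y ^ 2 + (((2 * n : ℕ) : ℝ) + 1) ^ 2) :=
    h1.summable.comp_injective (i := fun n : ℕ => 2 * n) fun a b h => by simpa using h
  have := (HasSum.even_add_odd (f := fun n : ℕ => 1 / (y ^ 2 + ((n : ℝ) + 1) ^ 2))
    heven.hasSum hodd).unique h1
  simp only [Nat.cast_mul, Nat.cast_ofNat] at heven this
  convert! heven.hasSum using 1
  rw [← eq_sub_iff_add_eq] at this
  rw [this, show π * (y / 2) = π * y / 2 by ring, show π * y = 2 * (π * y / 2) by ring,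
    show 2 * (π * y / 2) / 2 = π * y / 2 by ring,
    cosh_two_mul, sinh_two_mul, tanh_eq_sinh_div_cosh]
  have hs : sinh (π * y / 2) ≠ 0 := (Real.sinh_pos_iff.2 (by positivity)).ne'
  have hc := (cosh_pos (π * y / 2)).ne'
  field_simp
  ring

theorem hasSum_one_div_sq_add_odd_mul_pi_sq {x : ℝ} (hx : 0 < x) :
    HasSum (fun n : ℕ => 1 / (x ^ 2 + ((2 * (n : ℝ) + 1) * π) ^ 2)) (tanh (x / 2) / (4 * x)) := by
  have h := (hasSum_one_div_sq_add_odd_sq (div_pos hx pi_pos)).mul_left (1 / π ^ 2)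
  convert! h using 1
  · funext n
    field_simp
  · rw [mul_div_cancel₀ _ pi_ne_zero]
    field_simp

theorem integrableOn_exp_neg_mul {c : ℝ} (hc : 0 < c) :
    IntegrableOn (fun t : ℝ => exp (-c * t)) (Set.Ioi 0) :=
  integrableOn_exp_mul_Ioi (neg_lt_zero.2 hc) 0

theorem integrableOn_arctan_mul_exp_neg {c : ℝ} (hc : 0 < c) :
    IntegrableOn (fun t : ℝ => arctan t * exp (-c * t)) (Set.Ioi 0) := by
  refine Integrable.bdd_mul (c := π / 2) (integrableOn_exp_neg_mul hc)
    continuous_arctan.aestronglyMeasurable (.of_forall fun t => ?_)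
  rw [norm_eq_abs, abs_le]
  exact ⟨(neg_pi_div_two_lt_arctan t).le, (arctan_lt_pi_div_two t).le⟩

theorem integrableOn_exp_neg_div_sq_add_sq {c : ℝ} (hc : 0 < c) :
    IntegrableOn (fun x : ℝ => exp (-x) * (1 / (x ^ 2 + c ^ 2))) (Set.Ioi 0) := by
  refine Integrable.mul_bdd (c := 1 / c ^ 2) (integrableOn_exp_neg_Ioi 0)
    (Continuous.aestronglyMeasurable ?_) (.of_forall fun t => ?_)
  · exact continuous_const.div (by fun_prop) fun x => by positivity
  · rw [norm_of_nonneg (by positivity)]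
    gcongr
    nlinarith

theorem integral_arctan_mul_exp_neg {c : ℝ} (hc : 0 < c) :
    ∫ t in Set.Ioi 0, arctan t * exp (-c * t) =
      ∫ x in Set.Ioi 0, exp (-x) * (1 / (x ^ 2 + c ^ 2)) := by
  have hsub := integral_comp_mul_left_Ioi' (fun x => exp (-x) * (1 / (x ^ 2 + c ^ 2))) 0 hc
  have hint := (integrableOn_Ioi_comp_mul_left_iff
    (fun x => exp (-x) * (1 / (x ^ 2 + c ^ 2))) 0 hc).2
      (by simpa using integrableOn_exp_neg_div_sq_add_sq hc)
  rw [mul_zero] at hsub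
  rw [← hsub, ← integral_smul, ← sub_eq_zero,
    ← integral_sub (integrableOn_arctan_mul_exp_neg hc) (by exact hint.smul c)]
  have hderiv : ∀ t ∈ Set.Ici (0 : ℝ), HasDerivAt (fun t => -(1 / c) * (arctan t * exp (-c * t)))
      (arctan t * exp (-c * t) - c • (exp (-(c * t)) * (1 / ((c * t) ^ 2 + c ^ 2)))) t := by
    intro t _
    have h1 : HasDerivAt (fun t => exp (-c * t)) (exp (-c * t) * (-c)) t := by
      simpa using ((hasDerivAt_id t).const_mul (-c)).exp
    convert! ((hasDerivAt_arctan t).mul h1).const_mul (-(1 / c)) using 1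
    rw [smul_eq_mul, ← neg_mul]
    field_simp
    ring
  have hlim : Tendsto (fun t => -(1 / c) * (arctan t * exp (-c * t))) atTop (𝓝 0) := by
    have h1 : Tendsto (fun t => exp (-c * t)) atTop (𝓝 0) :=
      tendsto_exp_atBot.comp (tendsto_id.const_mul_atTop_of_neg (neg_lt_zero.2 hc))
    have h2 := (tendsto_arctan_atTop.mono_right nhdsWithin_le_nhds).mul h1
    simpa using h2.const_mul (-(1 / c))
  rw [integral_Ioi_of_hasDerivAt_of_tendsto' hderiv
    ((integrableOn_arctan_mul_exp_neg hc).sub (hint.smul c)) hlim]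
  simp

theorem hasSum_exp_odd_mul {u : ℝ} (hu : 0 < u) :
    HasSum (fun n : ℕ => 2 * exp (-(2 * n + 1) * u)) (1 / sinh u) := by
  have h := (hasSum_geometric_of_lt_one (exp_pos (-2 * u)).le
    (Real.exp_lt_one_iff.2 (by linarith))).mul_left (2 * exp (-u))
  convert! h using 1
  · funext n
    rw [← exp_nat_mul, mul_assoc, ← exp_add]
    ring_nf
  · have h1 : exp (-2 * u) = exp (-u) * exp (-u) := by rw [← exp_add]; ring_nf
    have h2 : exp (-u) < 1 := Real.exp_lt_one_iff.2 (by linarith)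
    have h4 : exp (-u) * exp u = 1 := by rw [← exp_add]; simp
    have h5 : exp u - exp (-u) ≠ 0 := by
      have := exp_lt_exp.2 (show -u < u by linarith)
      linarith
    have h3 : 1 - exp (-u) * exp (-u) ≠ 0 := by nlinarith [exp_pos (-u)]
    rw [h1, sinh_eq, one_div_div, ← div_eq_mul_inv, div_eq_div_iff h5 h3]
    linear_combination (-2) * h4

theorem hasSum_integral_exp_neg_div_sq_add_sq :
    HasSum (fun n : ℕ => ∫ x in Set.Ioi 0, exp (-x) * (1 / (x ^ 2 + ((2 * (n : ℝ) + 1) * π) ^ 2)))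
      (∫ x in Set.Ioi 0, exp (-x) * (tanh (x / 2) / (4 * x))) := by
  have hpos (n : ℕ) : 0 < (2 * (n : ℝ) + 1) * π := by positivity
  have key := hasSum_integral_of_summable_integral_norm
    (μ := volume.restrict (Set.Ioi (0 : ℝ)))
    (F := fun (n : ℕ) x => exp (-x) * (1 / (x ^ 2 + ((2 * (n : ℝ) + 1) * π) ^ 2)))
    (fun n => integrableOn_exp_neg_div_sq_add_sq (hpos n)) ?_
  · convert! key using 1
    refine setIntegral_congr_fun measurableSet_Ioi fun x hx => ?_
    exact ((hasSum_one_div_sq_add_odd_mul_pi_sq hx).mul_left (exp (-x))).tsum_eq.symm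
  · have h1 := (summable_nat_add_iff 1).2 (Real.summable_one_div_nat_pow.2 one_lt_two)
    refine h1.of_nonneg_of_le (fun n => integral_nonneg fun x => norm_nonneg _) fun n => ?_
    have h2 : ∫ x in Set.Ioi (0 : ℝ), exp (-x) * (1 / ((n : ℝ) + 1) ^ 2) = 1 / ((n : ℝ) + 1) ^ 2 := by
      rw [integral_mul_const, integral_exp_neg_Ioi_zero, one_mul]
    push_cast
    rw [← h2]
    refine integral_mono (integrableOn_exp_neg_div_sq_add_sq (hpos n)).norm
      (Integrable.mul_const (integrableOn_exp_neg_Ioi 0) _) fun x => ?_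
    dsimp only
    rw [norm_of_nonneg (by positivity)]
    gcongr
    have : (n : ℝ) + 1 ≤ (2 * (n : ℝ) + 1) * π := by nlinarith [pi_gt_three]
    nlinarith [sq_nonneg x, (by positivity : (0 : ℝ) < n + 1)]

theorem integral_arctan_div_sinh_eq :
    ∫ t in Set.Ioi (0 : ℝ), arctan t / sinh (π * t) =
      2 * ∫ x in Set.Ioi 0, exp (-x) * (tanh (x / 2) / (4 * x)) := by
  have hpos (n : ℕ) : 0 < (2 * (n : ℝ) + 1) * π := by positivity
  have hsum := hasSum_integral_exp_neg_div_sq_add_sq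
  simp_rw [← fun n : ℕ => integral_arctan_mul_exp_neg (hpos n)] at hsum
  have key := hasSum_integral_of_summable_integral_norm
    (μ := volume.restrict (Set.Ioi (0 : ℝ)))
    (fun n => integrableOn_arctan_mul_exp_neg (hpos n)) ?_
  · rw [← hsum.unique key |>.symm, ← integral_const_mul]
    refine setIntegral_congr_fun measurableSet_Ioi fun t ht => ?_
    have := (hasSum_exp_odd_mul (mul_pos pi_pos ht)).mul_left (arctan t / 2)
    have h2 : (fun n : ℕ => arctan t * exp (-((2 * (n : ℝ) + 1) * π) * t)) =
        fun n : ℕ => arctan t / 2 * (2 * exp (-(2 * n + 1) * (π * t))) := by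
      ext n
      rw [show -((2 * (n : ℝ) + 1) * π) * t = -(2 * n + 1) * (π * t) by ring]
      ring
    rw [h2, this.tsum_eq]
    ring
  · refine hsum.summable.congr fun n => setIntegral_congr_fun measurableSet_Ioi fun t ht => ?_
    rw [norm_of_nonneg (mul_nonneg (arctan_nonneg.2 (le_of_lt ht)) (exp_pos _).le)]

theorem integrableOn_exp_sub_exp_div {a b : ℝ} (ha : 0 < a) (hab : a ≤ b) :
    IntegrableOn (fun x : ℝ => x⁻¹ • (exp (-(a * x)) - exp (-(b * x)))) (Set.Ioi 0) := by
  refine Integrable.mono' ((integrableOn_exp_neg_mul ha).const_mul (b - a))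
    (by fun_prop) ((ae_restrict_iff' measurableSet_Ioi).2 (.of_forall fun x (hx : 0 < x) => ?_))
  have h1 : exp (-(b * x)) = exp (-(a * x)) * exp (-((b - a) * x)) := by
    rw [← exp_add]; ring_nf
  have h2 := add_one_le_exp (-((b - a) * x))
  have h3 : exp (-(b * x)) ≤ exp (-(a * x)) := by gcongr
  rw [norm_of_nonneg (smul_nonneg (by positivity) (sub_nonneg.2 h3)), smul_eq_mul,
    inv_mul_le_iff₀ hx, h1, neg_mul]
  nlinarith [exp_pos (-(a * x))]

theorem integral_exp_sub_exp_div {a b : ℝ} (ha : 0 < a) (hab : a ≤ b) :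
    ∫ x in Set.Ioi 0, x⁻¹ • (exp (-(a * x)) - exp (-(b * x))) = log (b / a) := by
  have hc : Continuous fun x : ℝ => exp (-x) := by fun_prop
  have h := Frullani.integral_Ioi_eq (f := fun x : ℝ => exp (-x)) (L := 1) (R := 0)
    (hc.locallyIntegrable.locallyIntegrableOn _) ha (ha.trans_le hab)
    ((by simpa using hc.tendsto 0 : Tendsto _ _ _).mono_left nhdsWithin_le_nhds)
    tendsto_exp_neg_atTop_nhds_zero (integrableOn_exp_sub_exp_div ha hab)
  simpa using h

theorem hasSum_log_wallis :
    HasSum (fun n : ℕ => log (((2 : ℝ) * n + 2) / (2 * n + 1) * ((2 * n + 2) / (2 * n + 3))))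
      (log (π / 2)) := by
  rw [hasSum_iff_tendsto_nat_of_nonneg]
  · have h := (continuousAt_log (by positivity : π / 2 ≠ 0)).tendsto.comp tendsto_prod_pi_div_two
    refine h.congr fun n => ?_
    exact log_prod fun i _ => by positivity
  · intro n
    apply log_nonneg
    rw [div_mul_div_comm, one_le_div (by positivity)]
    nlinarith

theorem integral_exp_neg_mul_tanh_div :
    ∫ x in Set.Ioi 0, exp (-x) * (tanh (x / 2) / (4 * x)) = 1 / 4 * log (π / 2) := by
  let F : ℕ → ℝ → ℝ := fun n x =>
    x⁻¹ • (exp (-((2 * n + 1) * x)) - exp (-((2 * n + 2) * x))) -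
      x⁻¹ • (exp (-((2 * n + 2) * x)) - exp (-((2 * n + 3) * x)))
  have hF (n : ℕ) (x : ℝ) : F n x = x⁻¹ * (exp (-x) * (1 - exp (-x)) ^ 2) * exp (-2 * x) ^ n := by
    simp only [F, smul_eq_mul]
    have h1 : exp (-((2 * n + 1) * x)) = exp (-x) * exp (-2 * x) ^ n := by
      rw [← exp_nat_mul, ← exp_add]; ring_nf
    have h2 : exp (-((2 * n + 2) * x)) = exp (-x) ^ 2 * exp (-2 * x) ^ n := by
      rw [← exp_nat_mul, ← exp_nat_mul, ← exp_add]; push_cast; ring_nf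
    have h3 : exp (-((2 * n + 3) * x)) = exp (-x) ^ 3 * exp (-2 * x) ^ n := by
      rw [← exp_nat_mul, ← exp_nat_mul, ← exp_add]; push_cast; ring_nf
    rw [h1, h2, h3]
    ring
  have hi1 (n : ℕ) := integrableOn_exp_sub_exp_div (a := 2 * n + 1) (b := 2 * n + 2)
    (by positivity) (by linarith)
  have hi2 (n : ℕ) := integrableOn_exp_sub_exp_div (a := 2 * n + 2) (b := 2 * n + 3)
    (by positivity) (by linarith)
  have hFint (n : ℕ) : ∫ x in Set.Ioi 0, F n x =
      log (((2 : ℝ) * n + 2) / (2 * n + 1) * ((2 * n + 2) / (2 * n + 3))) := by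
    rw [integral_sub (hi1 n) (hi2 n), integral_exp_sub_exp_div (by positivity) (by linarith),
      integral_exp_sub_exp_div (by positivity) (by linarith), ← log_div (by positivity)
      (by positivity), div_eq_mul_inv, inv_div]
  have hsum := hasSum_log_wallis
  simp_rw [← hFint] at hsum
  have key := hasSum_integral_of_summable_integral_norm
    (μ := volume.restrict (Set.Ioi (0 : ℝ))) (F := F) (fun n => (hi1 n).sub (hi2 n)) ?_
  · rw [← key.unique hsum, ← integral_const_mul]
    refine setIntegral_congr_fun measurableSet_Ioi fun x (hx : 0 < x) => ?_
    have hg := (hasSum_geometric_of_lt_one (exp_pos (-2 * x)).le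
      (Real.exp_lt_one_iff.2 (by linarith))).mul_left (x⁻¹ * (exp (-x) * (1 - exp (-x)) ^ 2))
    simp_rw [hF]
    rw [hg.tsum_eq, tanh_eq]
    have h1 : exp (-x) = exp (-(x / 2)) ^ 2 := by rw [← exp_nat_mul]; push_cast; ring_nf
    have h2 : exp (-2 * x) = exp (-(x / 2)) ^ 4 := by rw [← exp_nat_mul]; push_cast; ring_nf
    have h3 : exp (x / 2) = (exp (-(x / 2)))⁻¹ := by rw [← exp_neg, neg_neg]
    have h4 : exp (-(x / 2)) < 1 := Real.exp_lt_one_iff.2 (by linarith)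
    rw [h1, h2, h3]
    have h5 := exp_pos (-(x / 2))
    generalize exp (-(x / 2)) = q at h4 h5
    have h6 : 1 - q ^ 4 = (1 - q ^ 2) * (1 + q ^ 2) := by ring
    have h7 : 1 - q ^ 2 ≠ 0 := by nlinarith
    rw [h6]
    field_simp
  · refine hsum.summable.congr fun n => setIntegral_congr_fun measurableSet_Ioi fun x hx => ?_
    have : 0 < x := hx
    rw [hF, norm_of_nonneg (by positivity)]

theorem integral_arctan_div_sinh :
    ∫ t in Set.Ioi (0 : ℝ), Real.arctan t / Real.sinh (π * t) =
      (1 / 2) * Real.log π - (1 / 2) * Real.log 2 := by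
  rw [integral_arctan_div_sinh_eq, integral_exp_neg_mul_tanh_div,
    log_div pi_ne_zero two_ne_zero]
  ring
end
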